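/- (Gronwall estimate for controlled trajectories with common control.) Let $c:\mathbb{R}\times\mathbb{R}^d\to[0,\infty)$ and $v:\mathbb{R}\times\mathbb{R}^d\to\mathbb{R}^d$ be bounded and Lipschitz in the space variable uniformly in time. Let $|\cdot|$ be the Euclidean norm, and for $f\in\{v,c\}$ let $\mathrm{Lip}_x(f)$ be the smallest constant $L\ge 0$ such that $|f(s,x)-f(s,x')|\le L|x-x'|$ for all $s\in\mathbb{R}$ and $x,x'\in\mathbb{R}^d$. Set $C:=\sup|v|+\sup|c|+\mathrm{Lip}_x(v)+\mathrm{Lip}_x(c)$. Let $t,\tau\ge 0$, let $\alpha:[0,\max(t,\tau)]\to\mathbb{R}^d$ be measurable with $|\alpha(s)|\le 1$ for all $s$ and $\alpha(s)=0$ for $s>t$, and let $\gamma:[0,t]\to\mathbb{R}^d$ and $\beta:[0,\tau]\to\mathbb{R}^d$ be absolutely continuous paths satisfying $\gamma'(s)=v(s,\gamma(s))+c(s,\gamma(s))\alpha(s)$ for a.e. $s\in[0,t]$ and $\beta'(s)=v(s,\beta(s))+c(s,\beta(s))\alpha(s)$ for a.e. $s\in[0,\tau]$. If $\gamma(0)=y$,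 $\gamma(t)=x$, and $\beta(\tau)=z$, then $|y-\beta(0)|\le e^{C\tau'}\left(|x-z|+C|t-\tau|\right)$, where $\tau':=\min(t,\tau)$. -/

import Mathlib

open MeasureTheory Set
open scoped NNReal

/-- `ℝ^d` with the Euclidean norm. -/
abbrev Euc (d : ℕ) : Type := EuclideanSpace ℝ (Fin d)

/-- `f(s,x)` is bounded on `ℝ × E`. -/
def IsBoundedField {E F : Type*} [NormedAddCommGroup F] (f : ℝ → E → F) : Prop :=
  ∃ M : ℝ, ∀ s x, ‖f s x‖ ≤ M

/-- `sup |f|`, the supremum over all `(s,x)`; meaningful for bounded `f`. -/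
noncomputable def supField {E F : Type*} [NormedAddCommGroup F] (f : ℝ → E → F) : ℝ :=
  ⨆ p : ℝ × E, ‖f p.1 p.2‖

/-- `f(s,x)` is Lipschitz in `x`, uniformly in `s`. -/
def IsLipX {E F : Type*} [NormedAddCommGroup E] [NormedAddCommGroup F] (f : ℝ → E → F) : Prop :=
  ∃ K : ℝ≥0, ∀ s, LipschitzWith K (f s)

/-- `Lip_x(f)`, the smallest `K ≥ 0` such that every `f(s,·)` is `K`-Lipschitz; meaningful when
some such `K` exists. -/
noncomputable def lipX {E F : Type*} [NormedAddCommGroup E] [NormedAddCommGroup F]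
    (f : ℝ → E → F) : ℝ≥0 :=
  sInf {K : ℝ≥0 | ∀ s, LipschitzWith K (f s)}

/-- The infimum defining `lipX` is attained. -/
theorem isLeast_lipX {E F : Type*} [NormedAddCommGroup E] [NormedAddCommGroup F]
    {f : ℝ → E → F} (hf : IsLipX f) :
    IsLeast {K : ℝ≥0 | ∀ s, LipschitzWith K (f s)} (lipX f) := by
  refine ⟨?_, fun K hK => csInf_le (OrderBot.bddBelow _) hK⟩
  refine IsClosed.csInf_mem ?_ hf (OrderBot.bddBelow _)
  have h : {K : ℝ≥0 | ∀ s, LipschitzWith K (f s)} =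
      ⋂ (s : ℝ) (x : E) (y : E), {K : ℝ≥0 | dist (f s x) (f s y) ≤ K * dist x y} := by
    ext K
    simp only [mem_ofPred_eq, mem_iInter, lipschitzWith_iff_dist_le_mul]
  rw [h]
  refine isClosed_iInter fun s => isClosed_iInter fun x => isClosed_iInter fun y => ?_
  exact isClosed_le continuous_const (by fun_prop)

/-- `γ : [0,T] → ℝ^d` is absolutely continuous and `γ'(s) = v(s,γ(s)) + c(s,γ(s)) α(s)` for almost
every `s ∈ [0,T]`. (The values of `γ` outside `[0,T]` only affect the derivative at the two
endpoints, a null set.) -/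
def IsControlledTrajectory {d : ℕ} (v : ℝ → Euc d → Euc d) (c : ℝ → Euc d → ℝ) (α : ℝ → Euc d)
    (T : ℝ) (γ : ℝ → Euc d) : Prop :=
  AbsolutelyContinuousOnInterval γ 0 T ∧
    ∀ᵐ s ∂(volume.restrict (Icc (0 : ℝ) T)), HasDerivAt γ (v s (γ s) + c s (γ s) • α s) s

theorem LipschitzWith.comp_absolutelyContinuousOnInterval {X Y : Type*} [PseudoMetricSpace X]
    [PseudoMetricSpace Y] {K : ℝ≥0} {g : X → Y} (hg : LipschitzWith K g) {f : ℝ → X} {a b : ℝ}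
    (hf : AbsolutelyContinuousOnInterval f a b) :
    AbsolutelyContinuousOnInterval (fun s => g (f s)) a b := by
  have hf' := Filter.Tendsto.const_mul (K : ℝ) hf
  rw [mul_zero] at hf'
  refine squeeze_zero (fun _ => Finset.sum_nonneg fun _ _ => dist_nonneg) (fun E => ?_) hf'
  rw [Finset.mul_sum]
  exact Finset.sum_le_sum fun i _ => hg.dist_le_mul _ _

theorem AbsolutelyContinuousOnInterval.le_of_ae_hasDerivAt_nonneg {f f' : ℝ → ℝ} {a b : ℝ}
    (hab : a ≤ b) (hf : AbsolutelyContinuousOnInterval f a b)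
    (hd : ∀ᵐ s ∂(volume.restrict (Icc a b)), HasDerivAt f (f' s) s ∧ 0 ≤ f' s) : f a ≤ f b := by
  rw [← sub_nonneg, ← hf.integral_deriv_eq_sub]
  refine intervalIntegral.integral_nonneg_of_ae_restrict hab ?_
  filter_upwards [hd] with s hs
  simpa only [Pi.zero_apply, hs.1.deriv] using hs.2

section InnerProductSpace

variable {E : Type*} [NormedAddCommGroup E] [InnerProductSpace ℝ E]

/-- Mean value inequality for absolutely continuous paths. -/
theorem AbsolutelyContinuousOnInterval.norm_sub_le_of_ae_hasDerivAt {f f' : ℝ → E} {a b M : ℝ}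
    (hab : a ≤ b) (hf : AbsolutelyContinuousOnInterval f a b)
    (hd : ∀ᵐ s ∂(volume.restrict (Icc a b)), HasDerivAt f (f' s) s ∧ ‖f' s‖ ≤ M) :
    ‖f b - f a‖ ≤ M * (b - a) := by
  set w := f b - f a with hw
  rcases eq_or_ne w 0 with h0 | h0
  · have hM : 0 ≤ M * (b - a) := by
      rcases hab.eq_or_lt with rfl | hlt
      · simp
      · have : (ae (volume.restrict (Icc a b))).NeBot := by
          rw [ae_neBot, Ne, Measure.restrict_eq_zero, Real.volume_Icc]
          simpa using hlt
        obtain ⟨s, hs⟩ := hd.exists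
        exact mul_nonneg ((norm_nonneg _).trans hs.2) (sub_nonneg.2 hab)
    simpa [h0] using hM
  have hac : AbsolutelyContinuousOnInterval (fun s => M * ‖w‖ * s - inner ℝ w (f s)) a b := by
    refine AbsolutelyContinuousOnInterval.fun_sub ?_ ?_
    · exact ContDiffOn.absolutelyContinuousOnInterval (by fun_prop)
    · exact (innerSL ℝ w).lipschitz.comp_absolutelyContinuousOnInterval hf
  have key := hac.le_of_ae_hasDerivAt_nonneg
    (f' := fun s => M * ‖w‖ - inner ℝ w (f' s)) hab (by
      filter_upwards [hd] with s hs
      refine ⟨?_, ?_⟩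
      · have h1 := (hasDerivAt_id s).const_mul (M * ‖w‖)
        have h2 := (innerSL ℝ w).hasFDerivAt.comp_hasDerivAt s hs.1
        simpa using! h1.sub h2
      · have h1 := real_inner_le_norm w (f' s)
        have h2 := mul_le_mul_of_nonneg_left hs.2 (norm_nonneg w)
        linarith)
  have hin : inner ℝ w (f b) - inner ℝ w (f a) = ‖w‖ * ‖w‖ := by
    rw [← inner_sub_right, ← hw, real_inner_self_eq_norm_mul_norm]
  refine le_of_mul_le_mul_left ?_ (norm_pos_iff.2 h0)
  linarith

/-- Backward Gronwall inequality for absolutely continuous paths. -/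
theorem AbsolutelyContinuousOnInterval.norm_le_exp_mul_of_ae_hasDerivAt {f f' : ℝ → E}
    {a b K : ℝ} (hab : a ≤ b) (hf : AbsolutelyContinuousOnInterval f a b)
    (hd : ∀ᵐ s ∂(volume.restrict (Icc a b)), HasDerivAt f (f' s) s ∧ ‖f' s‖ ≤ K * ‖f s‖) :
    ‖f a‖ ≤ Real.exp (K * (b - a)) * ‖f b‖ := by
  have hn : AbsolutelyContinuousOnInterval (fun s => ‖f s‖) a b :=
    lipschitzWith_one_norm.comp_absolutelyContinuousOnInterval hf
  have hsq : AbsolutelyContinuousOnInterval (fun s => ‖f s‖ ^ 2) a b := by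
    simpa only [pow_two] using hn.fun_mul hn
  have he : AbsolutelyContinuousOnInterval (fun s => Real.exp (2 * K * (s - a))) a b :=
    ContDiffOn.absolutelyContinuousOnInterval (by fun_prop)
  have key := (he.fun_mul hsq).le_of_ae_hasDerivAt_nonneg
    (f' := fun s => Real.exp (2 * K * (s - a)) * (2 * K) * ‖f s‖ ^ 2 +
      Real.exp (2 * K * (s - a)) * (2 * inner ℝ (f s) (f' s))) hab (by
      filter_upwards [hd] with s hs
      refine ⟨?_, ?_⟩
      · have h1 : HasDerivAt (fun s => Real.exp (2 * K * (s - a)))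
            (Real.exp (2 * K * (s - a)) * (2 * K)) s := by
          simpa using (((hasDerivAt_id s).sub_const a).const_mul (2 * K)).exp
        exact h1.mul hs.1.norm_sq
      · have h1 := (abs_le.1 (abs_real_inner_le_norm (f s) (f' s))).1
        have h2 := mul_le_mul_of_nonneg_left hs.2 (norm_nonneg (f s))
        have h3 : 0 ≤ K * ‖f s‖ ^ 2 + inner ℝ (f s) (f' s) := by linarith
        have h4 := mul_nonneg (Real.exp_pos (2 * K * (s - a))).le h3
        linarith)
  refine le_of_sq_le_sq ?_ (by positivity)
  rw [mul_pow, ← Real.exp_nat_mul]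
  simpa [mul_assoc] using key

end InnerProductSpace

theorem IsBoundedField.norm_le_supField {E F : Type*} [NormedAddCommGroup F] {f : ℝ → E → F}
    (hf : IsBoundedField f) (s : ℝ) (x : E) : ‖f s x‖ ≤ supField f := by
  obtain ⟨M, hM⟩ := hf
  exact le_ciSup (f := fun p : ℝ × E => ‖f p.1 p.2‖)
    ⟨M, by rintro _ ⟨p, rfl⟩; exact hM p.1 p.2⟩ (s, x)

theorem supField_nonneg {E F : Type*} [NormedAddCommGroup F] (f : ℝ → E → F) : 0 ≤ supField f :=
  Real.iSup_nonneg fun _ => norm_nonneg _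

theorem IsLipX.norm_sub_le {E F : Type*} [NormedAddCommGroup E] [NormedAddCommGroup F]
    {f : ℝ → E → F} (hf : IsLipX f) (s : ℝ) (x x' : E) :
    ‖f s x - f s x'‖ ≤ lipX f * ‖x - x'‖ := by
  simpa only [dist_eq_norm] using ((isLeast_lipX hf).1 s).dist_le_mul x x'

theorem AbsolutelyContinuousOnInterval.mono_Icc {X : Type*} [PseudoMetricSpace X] {f : ℝ → X}
    {a b a' b' : ℝ} (hf : AbsolutelyContinuousOnInterval f a b) (ha : a ≤ a') (hab : a' ≤ b')
    (hb : b' ≤ b) : AbsolutelyContinuousOnInterval f a' b' := by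
  refine hf.mono ?_
  rw [uIcc_of_le hab, uIcc_of_le (ha.trans (hab.trans hb))]
  exact Icc_subset_Icc ha hb

section ControlledTrajectory

variable {d : ℕ} {v : ℝ → Euc d → Euc d} {c : ℝ → Euc d → ℝ} {α γ β : ℝ → Euc d} {T : ℝ}

/-- The speed of a controlled trajectory is at most `sup |v| + sup |c|`. -/
theorem IsControlledTrajectory.norm_sub_le (hγ : IsControlledTrajectory v c α T γ)
    (hv : IsBoundedField v) (hc : IsBoundedField c) (hα : ∀ s ∈ Icc 0 T, ‖α s‖ ≤ 1)
    {a : ℝ} (ha : 0 ≤ a) (haT : a ≤ T) :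
    ‖γ T - γ a‖ ≤ (supField v + supField c) * (T - a) := by
  refine (hγ.1.mono_Icc ha haT le_rfl).norm_sub_le_of_ae_hasDerivAt
    (f' := fun s => v s (γ s) + c s (γ s) • α s) haT ?_
  have hsub : Icc a T ⊆ Icc 0 T := Icc_subset_Icc_left ha
  filter_upwards [ae_restrict_of_ae_restrict_of_subset hsub hγ.2,
    ae_restrict_mem measurableSet_Icc] with s hs hsm
  refine ⟨hs, (norm_add_le _ _).trans (add_le_add (hv.norm_le_supField _ _) ?_)⟩
  rw [norm_smul]
  exact (mul_le_of_le_one_right (norm_nonneg _) (hα s (hsub hsm))).trans (hc.norm_le_supField _ _)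

/-- Two controlled trajectories with the same control, compared backwards in time. -/
theorem IsControlledTrajectory.norm_sub_le_exp_mul {T' : ℝ}
    (hγ : IsControlledTrajectory v c α T γ) (hβ : IsControlledTrajectory v c α T' β)
    (hv : IsLipX v) (hc : IsLipX c) {b : ℝ} (hb : 0 ≤ b) (hbT : b ≤ T) (hbT' : b ≤ T')
    (hα : ∀ s ∈ Icc 0 b, ‖α s‖ ≤ 1) :
    ‖γ 0 - β 0‖ ≤ Real.exp ((lipX v + lipX c) * b) * ‖γ b - β b‖ := by
  have hac := (hγ.1.mono_Icc le_rfl hb hbT).fun_sub (hβ.1.mono_Icc le_rfl hb hbT')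
  have key := hac.norm_le_exp_mul_of_ae_hasDerivAt (K := lipX v + lipX c)
    (f' := fun s => (v s (γ s) + c s (γ s) • α s) - (v s (β s) + c s (β s) • α s)) hb (by
      filter_upwards [ae_restrict_of_ae_restrict_of_subset (Icc_subset_Icc_right hbT) hγ.2,
        ae_restrict_of_ae_restrict_of_subset (Icc_subset_Icc_right hbT') hβ.2,
        ae_restrict_mem measurableSet_Icc] with s hs₁ hs₂ hsm
      refine ⟨hs₁.sub hs₂, ?_⟩
      rw [add_sub_add_comm, ← sub_smul, add_mul]
      refine (norm_add_le _ _).trans (add_le_add (hv.norm_sub_le _ _ _) ?_)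
      rw [norm_smul]
      exact (mul_le_of_le_one_right (norm_nonneg _) (hα s hsm)).trans (hc.norm_sub_le _ _ _))
  simpa only [sub_zero] using key

end ControlledTrajectory

/-- **Gronwall estimate for controlled trajectories with a common control.** -/
theorem gronwall_common_control {d : ℕ}
    (c : ℝ → Euc d → ℝ) (v : ℝ → Euc d → Euc d)
    (hc0 : ∀ s x, 0 ≤ c s x)
    (hc_bdd : IsBoundedField c) (hv_bdd : IsBoundedField v)
    (hc_lip : IsLipX c) (hv_lip : IsLipX v)
    (C : ℝ) (hC : C = supField v + supField c + lipX v + lipX c)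
    (t τ : ℝ) (ht : 0 ≤ t) (hτ : 0 ≤ τ)
    (α : ℝ → Euc d)
    (hα_meas : AEMeasurable α (volume.restrict (Icc (0 : ℝ) (max t τ))))
    (hα1 : ∀ s ∈ Icc (0 : ℝ) (max t τ), ‖α s‖ ≤ 1)
    (hα0 : ∀ s ∈ Icc (0 : ℝ) (max t τ), t < s → α s = 0)
    (γ β : ℝ → Euc d)
    (hγ : IsControlledTrajectory v c α t γ)
    (hβ : IsControlledTrajectory v c α τ β)
    (x y z : Euc d) (hγ0 : γ 0 = y) (hγt : γ t = x) (hβτ : β τ = z) :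
    ‖y - β 0‖ ≤ Real.exp (C * min t τ) * (‖x - z‖ + C * |t - τ|) := by
  subst hγ0 hγt hβτ
  have hv0 := supField_nonneg v
  have hc0' := supField_nonneg c
  have hlv : (0 : ℝ) ≤ lipX v := (lipX v).2
  have hlc : (0 : ℝ) ≤ lipX c := (lipX c).2
  have hmin : 0 ≤ min t τ := le_min ht hτ
  have hgr := hγ.norm_sub_le_exp_mul hβ hv_lip hc_lip hmin (min_le_left _ _) (min_le_right _ _)
    fun s hs => hα1 s ⟨hs.1, hs.2.trans min_le_max⟩
  have hend : ‖γ (min t τ) - β (min t τ)‖ ≤ ‖γ t - β τ‖ + C * |t - τ| := by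
    have hle : (supField v + supField c) * |t - τ| ≤ C * |t - τ| :=
      mul_le_mul_of_nonneg_right (by linarith) (abs_nonneg _)
    rcases le_total t τ with h | h
    · have hb := hβ.norm_sub_le hv_bdd hc_bdd
        (fun s hs => hα1 s ⟨hs.1, hs.2.trans (le_max_right _ _)⟩) ht h
      rw [abs_sub_comm, abs_of_nonneg (sub_nonneg.2 h)] at hle ⊢
      rw [min_eq_left h]
      have := norm_sub_le_norm_sub_add_norm_sub (γ t) (β τ) (β t)
      linarith
    · have hb := hγ.norm_sub_le hv_bdd hc_bdd
        (fun s hs => hα1 s ⟨hs.1, hs.2.trans (le_max_left _ _)⟩) hτ h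
      rw [abs_of_nonneg (sub_nonneg.2 h)] at hle ⊢
      rw [min_eq_right h]
      have := norm_sub_le_norm_sub_add_norm_sub (γ τ) (γ t) (β τ)
      rw [norm_sub_rev (γ τ) (γ t)] at this
      linarith
  refine hgr.trans (mul_le_mul (Real.exp_le_exp.2 ?_) hend (norm_nonneg _) (Real.exp_pos _).le)
  exact mul_le_mul_of_nonneg_right (by linarith) hmin
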